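/- Special case of the duality lemma with a fixed first-variable cube: let F ⊂ ℝ^{n+m}, K₀ ∈ 𝒟₀ⁿ, and 𝒞 ⊂ 𝒟₀ᵐ a collection of cubes with |(K₀×V) ∩ F| ≥ (99/100)|K₀×V| for all V ∈ 𝒞. Then for a translation ω₂ and scalars {a_{V+ω₂}}, {b_V}: Σ_{V∈𝒞}|a_{V+ω₂} b_V| ≲ ‖{a_{V+ω₂}}‖_{BMO(𝒟^m_{ω₂})} · ∬_F (1_{K₀}/|K₀|) ⊗ (Σ_{V∈𝒞}|b_V|² 1_V/|V|)^{1/2}. -/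

import Mathlib

open MeasureTheory Set Filter Topology ENNReal NNReal

noncomputable section

/-- The dyadic cube `∏ᵢ [2^{-k} nᵢ, 2^{-k}(nᵢ+1))` in `ℝᵈ`. -/
def dyadicCube (d : ℕ) (k : ℤ) (n : Fin d → ℤ) : Set (Fin d → ℝ) :=
  {x | ∀ i, (2:ℝ)^(-k) * (n i) ≤ x i ∧ x i < (2:ℝ)^(-k) * ((n i) + 1)}

/-- The dyadic child of `dyadicCube d k n` determined by the offsets `t`. -/
def dyadicChild (d : ℕ) (k : ℤ) (n : Fin d → ℤ) (t : Fin d → Fin 2) : Set (Fin d → ℝ) :=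
  dyadicCube d (k+1) (fun i => 2 * n i + (t i : ℕ))

/-- The average `⟨f⟩_S = |S|⁻¹ ∫_S f`. -/
def setAvg {X : Type*} [MeasureSpace X] (f : X → ℂ) (S : Set X) : ℂ :=
  (volume S).toReal⁻¹ • ∫ x in S, f x

/-- The martingale difference `Δ_I f = Σ_{I' ∈ ch(I)} (⟨f⟩_{I'} - ⟨f⟩_I) 1_{I'}` of the
dyadic cube `I = dyadicCube d k n`. -/
def mdiff (d : ℕ) (k : ℤ) (n : Fin d → ℤ) (f : (Fin d → ℝ) → ℂ) : (Fin d → ℝ) → ℂ :=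
  fun x => ∑ t : Fin d → Fin 2,
    (dyadicChild d k n t).indicator
      (fun _ => setAvg f (dyadicChild d k n t) - setAvg f (dyadicCube d k n)) x

/-- The translation vector `Σ_{i : 2^{-i} < 2^{-k}} 2^{-i} ωᵢ` used to define the random
dyadic grid, applied to cubes of side length `2^{-k}`. -/
def shiftVec (d : ℕ) (ω : ℤ → Fin d → Bool) (k : ℤ) : Fin d → ℝ :=
  fun i0 => ∑' i : ℤ, if k < i ∧ ω i i0 = true then (2:ℝ)^(-i) else 0

/-- The translated dyadic cube `I + ω` of the randomly shifted grid `𝒟^d_ω`. -/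
def tCube (d : ℕ) (ω : ℤ → Fin d → Bool) (k : ℤ) (n : Fin d → ℤ) : Set (Fin d → ℝ) :=
  {x | ∀ i, (2:ℝ)^(-k) * (n i) + shiftVec d ω k i ≤ x i ∧
        x i < (2:ℝ)^(-k) * ((n i) + 1) + shiftVec d ω k i}

/-- The dyadic rectangle `I × J ∈ 𝒟₀ = 𝒟₀ⁿ × 𝒟₀ᵐ` indexed by
`p = ((k₁,n₁),(k₂,n₂))`. -/
def baseRect (n m : ℕ) (p : (ℤ × (Fin n → ℤ)) × (ℤ × (Fin m → ℤ))) :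
    Set ((Fin n → ℝ) × (Fin m → ℝ)) :=
  dyadicCube n p.1.1 p.1.2 ×ˢ dyadicCube m p.2.1 p.2.2

/-- The translated dyadic rectangle `R + ω ∈ 𝒟_ω`. -/
def tRect (n m : ℕ) (ω₁ : ℤ → Fin n → Bool) (ω₂ : ℤ → Fin m → Bool)
    (p : (ℤ × (Fin n → ℤ)) × (ℤ × (Fin m → ℤ))) : Set ((Fin n → ℝ) × (Fin m → ℝ)) :=
  tCube n ω₁ p.1.1 p.1.2 ×ˢ tCube m ω₂ p.2.1 p.2.2

/-- The product BMO norm of a sequence of scalars `a` attached to the rectangles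
`rect i`: the supremum over admissible sets `Ω` (finite measure, and each point of `Ω`
lies in some grid rectangle contained in `Ω`) of `(|Ω|⁻¹ Σ_{rect i ⊆ Ω} |a i|²)^{1/2}`. -/
def bmoProdSeq {ι ι' : Type*} {Xs : Type*} [MeasureSpace Xs]
    (gridRect : ι' → Set Xs) (rect : ι → Set Xs) (a : ι → ℝ) : ℝ≥0∞ :=
  ⨆ (Ω : Set Xs) (_ : volume Ω < ⊤)
    (_ : ∀ x ∈ Ω, ∃ j, x ∈ gridRect j ∧ gridRect j ⊆ Ω),
    ((volume Ω)⁻¹ * ∑' i : {i // rect i ⊆ Ω}, ((‖a i.1‖₊ : ℝ≥0∞)) ^ 2) ^ ((1:ℝ)/2)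
/-- The BMO norm of a sequence of scalars attached to the cubes `cubes i` of the shifted
grid `𝒟^m_{ω₂}`: `sup_{V₀ ∈ 𝒟^m_{ω₂}} (|V₀|⁻¹ Σ_{V ⊆ V₀} |a_V|²)^{1/2}`. -/
def bmoSeqCube (m : ℕ) (ω₂ : ℤ → Fin m → Bool) {ι : Type*}
    (cubes : ι → Set (Fin m → ℝ)) (a : ι → ℝ) : ℝ≥0∞ :=
  ⨆ q : ℤ × (Fin m → ℤ),
    ((volume (tCube m ω₂ q.1 q.2))⁻¹ *
      ∑' i : {i // cubes i ⊆ tCube m ω₂ q.1 q.2}, ((‖a i.1‖₊ : ℝ≥0∞)) ^ 2) ^ ((1:ℝ)/2)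

lemma aux_volume_tCube (d : ℕ) (ω : ℤ → Fin d → Bool) (k : ℤ) (n : Fin d → ℤ) :
    volume (tCube d ω k n) = ENNReal.ofReal ((2:ℝ)^(-k)) ^ d := by
  have : tCube d ω k n = Set.pi univ (fun i => Ico ((2:ℝ)^(-k) * (n i) + shiftVec d ω k i)
      ((2:ℝ)^(-k) * ((n i) + 1) + shiftVec d ω k i)) := by
    ext x; simp [tCube]
  rw [this, Real.volume_pi_Ico]
  have h : ∀ i, ((2:ℝ)^(-k) * ((n i) + 1) + shiftVec d ω k i) -
      ((2:ℝ)^(-k) * (n i) + shiftVec d ω k i) = (2:ℝ)^(-k) := fun i => by ring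
  simp only [h, Finset.prod_const, Finset.card_univ, Fintype.card_fin]

lemma aux_dyadic_eq (d : ℕ) (k : ℤ) (n : Fin d → ℤ) :
    dyadicCube d k n = Set.pi univ (fun i => Ico ((2:ℝ)^(-k) * (n i))
      ((2:ℝ)^(-k) * ((n i) + 1))) := by
  ext x; simp [dyadicCube]

lemma aux_meas_dyadic (d : ℕ) (k : ℤ) (n : Fin d → ℤ) : MeasurableSet (dyadicCube d k n) := by
  rw [aux_dyadic_eq]
  exact MeasurableSet.univ_pi (fun i => measurableSet_Ico)

lemma aux_volume_dyadic (d : ℕ) (k : ℤ) (n : Fin d → ℤ) :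
    volume (dyadicCube d k n) = ENNReal.ofReal ((2:ℝ)^(-k)) ^ d := by
  rw [aux_dyadic_eq, Real.volume_pi_Ico]
  have h : ∀ i, ((2:ℝ)^(-k) * ((n i) + 1)) - ((2:ℝ)^(-k) * (n i)) = (2:ℝ)^(-k) :=
    fun i => by ring
  simp only [h, Finset.prod_const, Finset.card_univ, Fintype.card_fin]

lemma aux_vol_ne_zero (d : ℕ) (k : ℤ) : ENNReal.ofReal ((2:ℝ)^(-k)) ^ d ≠ 0 := by
  apply pow_ne_zero
  simp only [ne_eq, ENNReal.ofReal_eq_zero, not_le]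
  positivity

lemma aux_vol_ne_top (d : ℕ) (k : ℤ) : ENNReal.ofReal ((2:ℝ)^(-k)) ^ d ≠ ⊤ :=
  ENNReal.pow_ne_top ENNReal.ofReal_ne_top

lemma aux_summable (k : ℤ) (p : ℤ → Prop) [DecidablePred p] :
    Summable (fun i : ℤ => if k < i ∧ p i then (2:ℝ)^(-i) else 0) := by
  have h1 : Summable (fun j : ℕ => (2:ℝ)^(-k) * (1/2:ℝ)^j) :=
    (summable_geometric_of_lt_one (by norm_num) (by norm_num)).mul_left _
  have hinj : Function.Injective (fun j : ℕ => k + (j:ℤ)) := fun a b h => by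
    simpa using h
  rw [← hinj.summable_iff]
  · refine Summable.of_nonneg_of_le (fun j => ?_) (fun j => ?_) h1
    · simp only [Function.comp]
      split_ifs <;> positivity
    · simp only [Function.comp]
      have : (2:ℝ)^(-(k + (j:ℤ))) = (2:ℝ)^(-k) * (1/2:ℝ)^j := by
        rw [neg_add, zpow_add₀ (by norm_num)]
        simp
      rw [this]
      split_ifs
      · exact le_rfl
      · positivity
  · intro i hi
    rw [if_neg]
    rintro ⟨h, -⟩
    apply hi
    exact ⟨(i - k).toNat, by simp; omega⟩

lemma aux_shift_step (d : ℕ) (ω : ℤ → Fin d → Bool) (k : ℤ) (i0 : Fin d) :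
    shiftVec d ω k i0 = shiftVec d ω (k+1) i0 +
      (if ω (k+1) i0 = true then (2:ℝ)^(-(k+1)) else 0) := by
  unfold shiftVec
  have h2 : (∑' i : ℤ, if i = k + 1 then
      (if ω (k+1) i0 = true then (2:ℝ)^(-(k+1)) else 0) else 0) =
      (if ω (k+1) i0 = true then (2:ℝ)^(-(k+1)) else 0) := by
    rw [tsum_ite_eq]
  rw [← h2, ← Summable.tsum_add]
  · apply tsum_congr
    intro i
    by_cases hi : i = k + 1
    · subst hi; simp
    · have : k < i ↔ k + 1 < i := by omega
      simp [hi, this]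
  · exact aux_summable (k+1) (fun i => ω i i0 = true)
  · exact (hasSum_ite_eq (k+1) _).summable

lemma aux_shift (d : ℕ) (ω : ℤ → Fin d → Bool) (k : ℤ) (i0 : Fin d) (j : ℕ) :
    ∃ M : ℤ, 0 ≤ M ∧ M < 2 ^ j ∧
      shiftVec d ω k i0 = shiftVec d ω (k+j) i0 + (2:ℝ)^(-(k+j)) * M := by
  induction j with
  | zero => exact ⟨0, by simp⟩
  | succ j ih =>
    obtain ⟨M, h0, h1, h2⟩ := ih
    have h3 : (2:ℝ)^(-(k+(j:ℤ))) = 2 * (2:ℝ)^(-(k+((j+1:ℕ):ℤ))) := by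
      have : -(k+(j:ℤ)) = 1 + -(k+((j+1:ℕ):ℤ)) := by push_cast; ring
      rw [this, zpow_add₀ (by norm_num)]; simp
    have h4 := aux_shift_step d ω (k+j) i0
    have h5 : k + (j:ℤ) + 1 = k + ((j+1:ℕ):ℤ) := by push_cast; ring
    rw [h5] at h4
    by_cases hw : ω (k + ((j+1:ℕ):ℤ)) i0 = true
    · refine ⟨2*M+1, by omega, by rw [pow_succ]; omega, ?_⟩
      rw [h2, h4, if_pos hw, h3]; push_cast; ring
    · refine ⟨2*M, by omega, by rw [pow_succ]; omega, ?_⟩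
      rw [h2, h4, if_neg hw, h3]; push_cast; ring

/-- One-dimensional nesting in the shifted grid. -/
lemma aux_nest1 (d : ℕ) (ω : ℤ → Fin d → Bool) (k : ℤ) (i0 : Fin d) (j : ℕ) (N N' : ℤ)
    (y : ℝ) (hy1 : (2:ℝ)^(-k) * N ≤ y) (hy2 : y < (2:ℝ)^(-k) * (N + 1))
    (hy3 : (2:ℝ)^(-(k+j)) * N' ≤ y) (hy4 : y < (2:ℝ)^(-(k+j)) * (N' + 1)) :
    ∃ e : Fin 2, ∀ z : ℝ, (2:ℝ)^(-(k+j)) * N' + shiftVec d ω (k+j) i0 ≤ z →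
      z < (2:ℝ)^(-(k+j)) * (N' + 1) + shiftVec d ω (k+j) i0 →
      (2:ℝ)^(-k) * ((N - (e:ℕ) : ℤ) : ℝ) + shiftVec d ω k i0 ≤ z ∧
      z < (2:ℝ)^(-k) * (((N - (e:ℕ) : ℤ) : ℝ) + 1) + shiftVec d ω k i0 := by
  obtain ⟨M, h0, h1, h2⟩ := aux_shift d ω k i0 j
  set r : ℝ := (2:ℝ)^(-(k+(j:ℤ))) with hr
  have hrpos : 0 < r := by positivity
  have hk : (2:ℝ)^(-k) = r * ((2^j : ℤ) : ℝ) := by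
    have : -k = -(k+(j:ℤ)) + j := by ring
    rw [this, zpow_add₀ (by norm_num)]; simp [hr]
  set L : ℤ := 2^j with hL
  rw [hk] at hy1 hy2 ⊢
  have hA : N * L ≤ N' := by
    have : r * (L * N) < r * (N' + 1) := by rw [← mul_assoc]; linarith
    have := lt_of_mul_lt_mul_left this hrpos.le
    have : L * N < N' + 1 := by exact_mod_cast this
    linarith
  have hB : N' + 1 ≤ (N + 1) * L := by
    have : r * N' < r * (L * (N + 1)) := by rw [← mul_assoc]; linarith
    have := lt_of_mul_lt_mul_left this hrpos.le
    have : N' < L * (N + 1) := by exact_mod_cast this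
    linarith
  have key : ∀ N₁ : ℤ, L * N₁ ≤ N' - M → N' - M + 1 ≤ L * (N₁ + 1) →
      ∀ z : ℝ, r * N' + shiftVec d ω (k+j) i0 ≤ z →
      z < r * (N' + 1) + shiftVec d ω (k+j) i0 →
      r * L * ((N₁ : ℤ) : ℝ) + shiftVec d ω k i0 ≤ z ∧
      z < r * L * (((N₁ : ℤ) : ℝ) + 1) + shiftVec d ω k i0 := by
    intro N₁ ha hb z hz1 hz2
    have ha' : (L:ℝ) * N₁ ≤ N' - M := by exact_mod_cast ha
    have hb' : (N':ℝ) - M + 1 ≤ L * (N₁ + 1) := by exact_mod_cast hb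
    have ha2 := mul_le_mul_of_nonneg_left ha' hrpos.le
    have hb2 := mul_le_mul_of_nonneg_left hb' hrpos.le
    rw [h2]
    constructor <;> nlinarith
  by_cases hc : N * L ≤ N' - M
  · refine ⟨0, ?_⟩
    have := key N (by linarith) (by linarith)
    simpa using this
  · refine ⟨1, ?_⟩
    have := key (N - 1) (by linarith) (by push Not at hc; linarith)
    simpa using this

lemma aux_nest (d : ℕ) (ω : ℤ → Fin d → Bool) (q q' : ℤ × (Fin d → ℤ)) (hk : q.1 ≤ q'.1)
    (hne : (dyadicCube d q'.1 q'.2 ∩ dyadicCube d q.1 q.2).Nonempty) :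
    ∃ e : Fin d → Fin 2, tCube d ω q'.1 q'.2 ⊆ tCube d ω q.1 (fun i => q.2 i - ((e i : ℕ):ℤ)) := by
  obtain ⟨y, hy', hy⟩ := hne
  obtain ⟨k, N⟩ := q
  obtain ⟨k', N'⟩ := q'
  obtain ⟨j, rfl⟩ := Int.le.dest hk
  choose e he using fun i => aux_nest1 d ω k i j (N i) (N' i) (y i) (hy i).1 (hy i).2
    (hy' i).1 (hy' i).2
  exact ⟨e, fun z hz i => he i (z i) (hz i).1 (hz i).2⟩

lemma aux_cs {ι : Type*} (f g : ι → ℝ≥0∞) :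
    ∑' i, f i * g i ≤ (∑' i, f i ^ 2) ^ ((1:ℝ)/2) * (∑' i, g i ^ 2) ^ ((1:ℝ)/2) := by
  rw [ENNReal.tsum_eq_iSup_sum]
  refine iSup_le fun s => ?_
  refine (ENNReal.inner_le_Lp_mul_Lq s f g Real.HolderConjugate.two_two).trans ?_
  simp only [ENNReal.rpow_two]
  gcongr <;> exact ENNReal.sum_le_tsum s

lemma aux_bmo (m : ℕ) (ω₂ : ℤ → Fin m → Bool) {ι : Type*}
    (cubes : ι → Set (Fin m → ℝ)) (a : ι → ℝ) (q : ℤ × (Fin m → ℤ)) :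
    ∑' i : {i // cubes i ⊆ tCube m ω₂ q.1 q.2}, ((‖a i.1‖₊ : ℝ≥0∞)) ^ 2 ≤
      bmoSeqCube m ω₂ cubes a ^ 2 * volume (tCube m ω₂ q.1 q.2) := by
  set S := ∑' i : {i // cubes i ⊆ tCube m ω₂ q.1 q.2}, ((‖a i.1‖₊ : ℝ≥0∞)) ^ 2
  have h : ((volume (tCube m ω₂ q.1 q.2))⁻¹ * S) ^ ((1:ℝ)/2) ≤ bmoSeqCube m ω₂ cubes a :=
    le_iSup (fun q : ℤ × (Fin m → ℤ) => ((volume (tCube m ω₂ q.1 q.2))⁻¹ *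
      ∑' i : {i // cubes i ⊆ tCube m ω₂ q.1 q.2}, ((‖a i.1‖₊ : ℝ≥0∞)) ^ 2) ^ ((1:ℝ)/2)) q
  have h2 := pow_le_pow_left₀ zero_le h 2
  rw [← ENNReal.rpow_two, ← ENNReal.rpow_mul] at h2
  norm_num at h2
  have hv0 : volume (tCube m ω₂ q.1 q.2) ≠ 0 := by
    rw [aux_volume_tCube]; exact aux_vol_ne_zero _ _
  have hvt : volume (tCube m ω₂ q.1 q.2) ≠ ⊤ := by
    rw [aux_volume_tCube]; exact aux_vol_ne_top _ _
  calc S = ((volume (tCube m ω₂ q.1 q.2))⁻¹ * S) * volume (tCube m ω₂ q.1 q.2) := by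
        rw [mul_comm, ← mul_assoc, ENNReal.mul_inv_cancel hv0 hvt, one_mul]
    _ ≤ _ := by gcongr

/-- The local square function of `a` below the scale `k`. -/
def auxA (m : ℕ) (𝒞 : Set (ℤ × (Fin m → ℤ))) (a : ℤ × (Fin m → ℤ) → ℝ) (k : ℤ)
    (x : Fin m → ℝ) : ℝ≥0∞ :=
  ∑' q : 𝒞, (if k ≤ q.1.1 then (‖a q.1‖₊ : ℝ≥0∞) ^ 2 else 0) *
    (dyadicCube m q.1.1 q.1.2).indicator (fun _ => (volume (dyadicCube m q.1.1 q.1.2))⁻¹) x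

lemma aux_meas_A (m : ℕ) (𝒞 : Set (ℤ × (Fin m → ℤ))) (a : ℤ × (Fin m → ℤ) → ℝ) (k : ℤ) :
    Measurable (auxA m 𝒞 a k) := by
  unfold auxA
  refine Measurable.tsum fun q => ?_
  exact (measurable_const.indicator (aux_meas_dyadic _ _ _)).const_mul _

lemma aux_int_A (m : ℕ) (ω₂ : ℤ → Fin m → Bool) (𝒞 : Set (ℤ × (Fin m → ℤ)))
    (a : ℤ × (Fin m → ℤ) → ℝ) (q : ℤ × (Fin m → ℤ)) :
    ∫⁻ x in dyadicCube m q.1 q.2, auxA m 𝒞 a q.1 x ≤ 2 ^ m *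
      (bmoSeqCube m ω₂ (fun q : 𝒞 => tCube m ω₂ q.1.1 q.1.2) (fun q : 𝒞 => a q.1) ^ 2 *
        volume (dyadicCube m q.1 q.2)) := by
  classical
  unfold auxA
  rw [lintegral_tsum fun q' =>
    ((measurable_const.indicator (aux_meas_dyadic _ _ _)).const_mul _).aemeasurable]
  set W : (Fin m → Fin 2) → Set (Fin m → ℝ) :=
    fun e => tCube m ω₂ q.1 (fun i => q.2 i - ((e i : ℕ):ℤ)) with hW
  have step : ∀ q' : 𝒞, (∫⁻ x in dyadicCube m q.1 q.2,
      (if q.1 ≤ q'.1.1 then (‖a q'.1‖₊ : ℝ≥0∞) ^ 2 else 0) *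
      (dyadicCube m q'.1.1 q'.1.2).indicator
        (fun _ => (volume (dyadicCube m q'.1.1 q'.1.2))⁻¹) x) ≤
      ∑ e : Fin m → Fin 2, {i : 𝒞 | tCube m ω₂ i.1.1 i.1.2 ⊆ W e}.indicator
        (fun i : 𝒞 => (‖a i.1‖₊ : ℝ≥0∞) ^ 2) q' := by
    intro q'
    rw [lintegral_const_mul _ (measurable_const.indicator (aux_meas_dyadic _ _ _)),
      lintegral_indicator_const (aux_meas_dyadic _ _ _),
      Measure.restrict_apply (aux_meas_dyadic _ _ _)]
    by_cases hk : q.1 ≤ q'.1.1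
    swap
    · simp [hk]
    by_cases hne : (dyadicCube m q'.1.1 q'.1.2 ∩ dyadicCube m q.1 q.2).Nonempty
    swap
    · rw [not_nonempty_iff_eq_empty.1 hne]; simp
    obtain ⟨e, he⟩ := aux_nest m ω₂ q q'.1 hk hne
    refine le_trans ?_ (Finset.single_le_sum (f := fun e : Fin m → Fin 2 =>
      {i : 𝒞 | tCube m ω₂ i.1.1 i.1.2 ⊆ W e}.indicator
        (fun i : 𝒞 => (‖a i.1‖₊ : ℝ≥0∞) ^ 2) q') (fun _ _ => zero_le) (Finset.mem_univ e))
    rw [indicator_of_mem (show q' ∈ {i : 𝒞 | tCube m ω₂ i.1.1 i.1.2 ⊆ W e} from he), if_pos hk]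
    have : (volume (dyadicCube m q'.1.1 q'.1.2))⁻¹ *
        volume (dyadicCube m q'.1.1 q'.1.2 ∩ dyadicCube m q.1 q.2) ≤ 1 := by
      calc _ ≤ (volume (dyadicCube m q'.1.1 q'.1.2))⁻¹ * volume (dyadicCube m q'.1.1 q'.1.2) := by
            gcongr; exact inter_subset_left
        _ ≤ 1 := ENNReal.inv_mul_le_one _
    calc _ ≤ (‖a q'.1‖₊ : ℝ≥0∞) ^ 2 * 1 := by gcongr
      _ = _ := mul_one _
  refine (ENNReal.tsum_le_tsum step).trans ?_
  rw [Summable.tsum_finsetSum (fun _ _ => ENNReal.summable)]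
  have step2 : ∀ e : Fin m → Fin 2, ∑' q' : 𝒞, {i : 𝒞 | tCube m ω₂ i.1.1 i.1.2 ⊆ W e}.indicator
        (fun i : 𝒞 => (‖a i.1‖₊ : ℝ≥0∞) ^ 2) q' ≤
      bmoSeqCube m ω₂ (fun q : 𝒞 => tCube m ω₂ q.1.1 q.1.2) (fun q : 𝒞 => a q.1) ^ 2 *
        volume (dyadicCube m q.1 q.2) := by
    intro e
    rw [← tsum_subtype]
    have := aux_bmo m ω₂ (fun q : 𝒞 => tCube m ω₂ q.1.1 q.1.2) (fun q : 𝒞 => a q.1)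
      (q.1, (fun i => q.2 i - ((e i : ℕ):ℤ)))
    rw [aux_volume_tCube] at this
    rw [aux_volume_dyadic]
    exact this
  refine (Finset.sum_le_sum (fun e _ => step2 e)).trans ?_
  simp

/-- The good part of the cube `q` at level `l`. -/
def auxE (m : ℕ) (𝒞 : Set (ℤ × (Fin m → ℤ))) (a : ℤ × (Fin m → ℤ) → ℝ) (l : ℝ≥0∞)
    (q : ℤ × (Fin m → ℤ)) : Set (Fin m → ℝ) :=
  dyadicCube m q.1 q.2 ∩ {x | auxA m 𝒞 a q.1 x ≤ l}

lemma aux_meas_E (m : ℕ) (𝒞 : Set (ℤ × (Fin m → ℤ))) (a : ℤ × (Fin m → ℤ) → ℝ) (l : ℝ≥0∞)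
    (q : ℤ × (Fin m → ℤ)) : MeasurableSet (auxE m 𝒞 a l q) :=
  (aux_meas_dyadic _ _ _).inter (measurableSet_le (aux_meas_A _ _ _ _) measurable_const)

lemma aux_pointwise (m : ℕ) (𝒞 : Set (ℤ × (Fin m → ℤ))) (a : ℤ × (Fin m → ℤ) → ℝ) (l : ℝ≥0∞)
    (x : Fin m → ℝ) :
    ∑' q : 𝒞, (‖a q.1‖₊ : ℝ≥0∞) ^ 2 *
      (auxE m 𝒞 a l q.1).indicator (fun _ => (volume (dyadicCube m q.1.1 q.1.2))⁻¹) x ≤ l := by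
  classical
  rw [ENNReal.tsum_eq_iSup_sum]
  refine iSup_le fun s => ?_
  set t := s.filter (fun q => x ∈ auxE m 𝒞 a l q.1) with ht
  have hst : ∑ q ∈ s, (‖a q.1‖₊ : ℝ≥0∞) ^ 2 *
      (auxE m 𝒞 a l q.1).indicator (fun _ => (volume (dyadicCube m q.1.1 q.1.2))⁻¹) x =
      ∑ q ∈ t, (‖a q.1‖₊ : ℝ≥0∞) ^ 2 *
      (auxE m 𝒞 a l q.1).indicator (fun _ => (volume (dyadicCube m q.1.1 q.1.2))⁻¹) x := by
    rw [ht, Finset.sum_filter]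
    refine Finset.sum_congr rfl fun q _ => ?_
    by_cases hx : x ∈ auxE m 𝒞 a l q.1 <;> simp [hx]
  rw [hst]
  rcases t.eq_empty_or_nonempty with h0 | h0
  · simp [h0]
  obtain ⟨q0, hq0, hmin⟩ := t.exists_min_image (fun q => q.1.1) h0
  have hx0 : x ∈ auxE m 𝒞 a l q0.1 := (Finset.mem_filter.1 hq0).2
  refine le_trans ?_ hx0.2
  refine le_trans (Finset.sum_le_sum fun q hq => ?_) (ENNReal.sum_le_tsum t)
  have hxq : x ∈ auxE m 𝒞 a l q.1 := (Finset.mem_filter.1 hq).2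
  rw [if_pos (hmin q hq), indicator_of_mem hxq, indicator_of_mem hxq.1]

lemma aux_bad (m : ℕ) (ω₂ : ℤ → Fin m → Bool) (𝒞 : Set (ℤ × (Fin m → ℤ)))
    (a : ℤ × (Fin m → ℤ) → ℝ) (q : ℤ × (Fin m → ℤ)) (B : ℝ≥0∞)
    (hB : B = bmoSeqCube m ω₂ (fun q : 𝒞 => tCube m ω₂ q.1.1 q.1.2) (fun q : 𝒞 => a q.1))
    (hB0 : B ≠ 0) :
    4 * volume (dyadicCube m q.1 q.2 \ auxE m 𝒞 a (4 * 2 ^ m * B ^ 2) q) ≤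
      volume (dyadicCube m q.1 q.2) := by
  set l : ℝ≥0∞ := 4 * 2 ^ m * B ^ 2 with hl
  have hsub : dyadicCube m q.1 q.2 \ auxE m 𝒞 a l q ⊆
      {x | l < auxA m 𝒞 a q.1 x} ∩ dyadicCube m q.1 q.2 := by
    rintro x ⟨h1, h2⟩
    refine ⟨?_, h1⟩
    by_contra h
    exact h2 ⟨h1, show auxA m 𝒞 a q.1 x ≤ l from not_lt.1 h⟩
  by_cases hBt : B = ⊤
  · have hlt : l = ⊤ := by
      rw [hl, hBt]
      simp [ENNReal.mul_top]
    have : dyadicCube m q.1 q.2 \ auxE m 𝒞 a l q = ∅ := by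
      rw [← subset_empty_iff]
      refine hsub.trans ?_
      rintro x ⟨h, -⟩
      simp [hlt] at h
    simp [this]
  have h1 := aux_int_A m ω₂ 𝒞 a q
  rw [← hB] at h1
  have h2 := mul_meas_ge_le_lintegral (μ := volume.restrict (dyadicCube m q.1 q.2))
    (aux_meas_A m 𝒞 a q.1) l
  have h3 : volume (dyadicCube m q.1 q.2 \ auxE m 𝒞 a l q) ≤
      (volume.restrict (dyadicCube m q.1 q.2)) {x | l ≤ auxA m 𝒞 a q.1 x} := by
    rw [Measure.restrict_apply (measurableSet_le measurable_const (aux_meas_A _ _ _ _))]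
    refine measure_mono (hsub.trans ?_)
    exact inter_subset_inter_left _ (fun x (hx : l < auxA m 𝒞 a q.1 x) =>
      show l ≤ auxA m 𝒞 a q.1 x from le_of_lt hx)
  have h4 : (2 ^ m * B ^ 2) * (4 * volume (dyadicCube m q.1 q.2 \ auxE m 𝒞 a l q)) ≤
      (2 ^ m * B ^ 2) * volume (dyadicCube m q.1 q.2) := by
    calc _ = l * volume (dyadicCube m q.1 q.2 \ auxE m 𝒞 a l q) := by rw [hl]; ring
      _ ≤ _ := mul_le_mul_right h3 l
      _ ≤ _ := h2.trans h1
      _ = _ := by ring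
  have hc0 : (2 ^ m * B ^ 2 : ℝ≥0∞) ≠ 0 := mul_ne_zero (by simp) (pow_ne_zero _ hB0)
  have hct : (2 ^ m * B ^ 2 : ℝ≥0∞) ≠ ⊤ :=
    ENNReal.mul_ne_top (ENNReal.pow_ne_top (by simp)) (ENNReal.pow_ne_top hBt)
  exact (ENNReal.mul_le_mul_iff_right hc0 hct).1 h4

lemma aux_arith (t x y : ℝ≥0∞) (ht : t ≠ ⊤) (h1 : (99/100 : ℝ≥0∞) * t ≤ x + y)
    (h2 : 4 * y ≤ t) : t ≤ 2 * x := by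
  by_cases hx : x = ⊤
  · simp [hx]
  have hy : y ≠ ⊤ := by
    rintro rfl
    simp at h2
    exact ht h2
  lift t to ℝ≥0 using ht
  lift x to ℝ≥0 using hx
  lift y to ℝ≥0 using hy
  have e : (99/100 : ℝ≥0∞) = ((99/100 : ℝ≥0) : ℝ≥0∞) := by
    rw [ENNReal.coe_div (by norm_num)]; simp
  rw [e] at h1
  have h1' : (99/100 : ℝ≥0) * t ≤ x + y := by exact_mod_cast h1
  have h2' : 4 * y ≤ t := by exact_mod_cast h2
  have : t ≤ 2 * x := by
    rw [← NNReal.coe_le_coe] at *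
    push_cast at *
    linarith [x.2]
  exact_mod_cast this

/-- Special case of the duality lemma with a fixed first-variable cube `K₀ ∈ 𝒟₀ⁿ`: if every
`V ∈ 𝒞 ⊆ 𝒟₀ᵐ` satisfies `|(K₀×V) ∩ F| ≥ (99/100)|K₀×V|`, then
`Σ_{V∈𝒞}|a_{V+ω₂} b_V| ≤ C ‖{a_{V+ω₂}}‖_{BMO(𝒟^m_{ω₂})}
  ∬_F (1_{K₀}/|K₀|) ⊗ (Σ_{V∈𝒞}|b_V|² 1_V/|V|)^{1/2}`,
with `C` depending only on the dimensions. -/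
theorem duality_bmo_fixed_cube (n m : ℕ) :
    ∃ C : ℝ≥0∞, 0 < C ∧ C ≠ ⊤ ∧
      ∀ (F : Set ((Fin n → ℝ) × (Fin m → ℝ)))
        (kK : ℤ) (nK : Fin n → ℤ) (ω₂ : ℤ → Fin m → Bool)
        (𝒞 : Set (ℤ × (Fin m → ℤ)))
        (a b : ℤ × (Fin m → ℤ) → ℝ),
        (∀ q ∈ 𝒞, (99/100 : ℝ≥0∞) *
            volume (dyadicCube n kK nK ×ˢ dyadicCube m q.1 q.2) ≤
          volume ((dyadicCube n kK nK ×ˢ dyadicCube m q.1 q.2) ∩ F)) →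
        (∑' q : 𝒞, ((‖a q.1‖₊ : ℝ≥0∞) * ‖b q.1‖₊)) ≤
          C * bmoSeqCube m ω₂ (fun q : 𝒞 => tCube m ω₂ q.1.1 q.1.2) (fun q : 𝒞 => a q.1) *
            ∫⁻ x in F,
              (dyadicCube n kK nK).indicator
                  (fun _ => (volume (dyadicCube n kK nK))⁻¹) x.1 *
                (∑' q : 𝒞, (‖b q.1‖₊ : ℝ≥0∞) ^ 2 *
                  (dyadicCube m q.1.1 q.1.2).indicator
                    (fun _ => (volume (dyadicCube m q.1.1 q.1.2))⁻¹) x.2)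
                  ^ ((1:ℝ)/2) := by
  have hrt : ((4 * 2 ^ m : ℝ≥0∞) ^ ((1:ℝ)/2)) ≠ ⊤ :=
    ENNReal.rpow_ne_top_of_nonneg (by norm_num)
      (ENNReal.mul_ne_top (by simp) (ENNReal.pow_ne_top (by simp)))
  refine ⟨2 * (4 * 2 ^ m) ^ ((1:ℝ)/2), ?_, ENNReal.mul_ne_top (by simp) hrt, ?_⟩
  · refine ENNReal.mul_pos (by simp) (ENNReal.rpow_pos ?_ ?_).ne'
    · exact ENNReal.mul_pos (by simp) (by simp)
    · exact ENNReal.mul_ne_top (by simp) (ENNReal.pow_ne_top (by simp))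
  intro F kK nK ω₂ 𝒞 a b hF
  set B := bmoSeqCube m ω₂ (fun q : 𝒞 => tCube m ω₂ q.1.1 q.1.2) (fun q : 𝒞 => a q.1) with hB
  by_cases hB0 : B = 0
  · have ha : ∀ q : 𝒞, (‖a q.1‖₊ : ℝ≥0∞) = 0 := by
      intro q
      have h := aux_bmo m ω₂ (fun q : 𝒞 => tCube m ω₂ q.1.1 q.1.2) (fun q : 𝒞 => a q.1) q.1
      rw [← hB, hB0] at h
      have h3 := le_antisymm (h.trans (by simp)) zero_le
      have h2 := ENNReal.tsum_eq_zero.1 h3 ⟨q, Subset.rfl⟩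
      simpa using h2
    simp [ha]
  set K := dyadicCube n kK nK with hK
  have hKm : MeasurableSet K := aux_meas_dyadic _ _ _
  have hK0 : volume K ≠ 0 := by rw [hK, aux_volume_dyadic]; exact aux_vol_ne_zero _ _
  have hKt : volume K ≠ ⊤ := by rw [hK, aux_volume_dyadic]; exact aux_vol_ne_top _ _
  have hVm : ∀ q : ℤ × (Fin m → ℤ), MeasurableSet (dyadicCube m q.1 q.2) :=
    fun q => aux_meas_dyadic _ _ _
  have hV0 : ∀ q : ℤ × (Fin m → ℤ), volume (dyadicCube m q.1 q.2) ≠ 0 :=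
    fun q => by rw [aux_volume_dyadic]; exact aux_vol_ne_zero _ _
  have hVt : ∀ q : ℤ × (Fin m → ℤ), volume (dyadicCube m q.1 q.2) ≠ ⊤ :=
    fun q => by rw [aux_volume_dyadic]; exact aux_vol_ne_top _ _
  set l : ℝ≥0∞ := 4 * 2 ^ m * B ^ 2 with hl
  set E := auxE m 𝒞 a l with hE
  have hEm : ∀ q, MeasurableSet (E q) := fun q => aux_meas_E _ _ _ _ _
  have hEV : ∀ q, E q ⊆ dyadicCube m q.1 q.2 := fun q => inter_subset_left
  -- the good part captures a fixed proportion of `F`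
  have hgood : ∀ q ∈ 𝒞, volume K * volume (dyadicCube m q.1 q.2) ≤
      2 * volume ((K ×ˢ E q) ∩ F) := by
    intro q hq
    refine aux_arith _ _ (volume K * volume (dyadicCube m q.1 q.2 \ E q))
      (ENNReal.mul_ne_top hKt (hVt q)) ?_ ?_
    · have h := hF q hq
      rw [Measure.volume_eq_prod, Measure.prod_prod, ← Measure.volume_eq_prod] at h
      refine h.trans ?_
      rw [← Measure.prod_prod, ← Measure.volume_eq_prod]
      refine le_trans (measure_mono ?_) (measure_union_le _ _)
      rintro ⟨x, y⟩ ⟨⟨hx, hy⟩, hxy⟩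
      by_cases hyE : y ∈ E q
      · exact Or.inl ⟨⟨hx, hyE⟩, hxy⟩
      · exact Or.inr ⟨hx, hy, hyE⟩
    · have := aux_bad m ω₂ 𝒞 a q B hB hB0
      calc _ = volume K * (4 * volume (dyadicCube m q.1 q.2 \ E q)) := by ring
        _ ≤ _ := by gcongr
  -- pass to the integral
  set G : 𝒞 → ((Fin n → ℝ) × (Fin m → ℝ)) → ℝ≥0∞ := fun q x =>
    ((‖a q.1‖₊ : ℝ≥0∞) * ‖b q.1‖₊) * (K ×ˢ E q.1).indicator
      (fun _ => (volume K)⁻¹ * (volume (dyadicCube m q.1.1 q.1.2))⁻¹) x with hG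
  have hGm : ∀ q, Measurable (G q) := fun q =>
    (measurable_const.indicator (hKm.prod (hEm q.1))).const_mul _
  have h1 : ∑' q : 𝒞, ((‖a q.1‖₊ : ℝ≥0∞) * ‖b q.1‖₊) ≤
      2 * ∫⁻ x in F, ∑' q : 𝒞, G q x := by
    rw [lintegral_tsum fun q => (hGm q).aemeasurable, ← ENNReal.tsum_mul_left]
    refine ENNReal.tsum_le_tsum fun q => ?_
    rw [hG]
    simp only
    rw [lintegral_const_mul _ (measurable_const.indicator (hKm.prod (hEm q.1))),
      lintegral_indicator_const (hKm.prod (hEm q.1)),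
      Measure.restrict_apply (hKm.prod (hEm q.1))]
    have hg := hgood q.1 q.2
    have : 1 ≤ (volume K)⁻¹ * (volume (dyadicCube m q.1.1 q.1.2))⁻¹ *
        (2 * volume ((K ×ˢ E q.1) ∩ F)) := by
      calc (1:ℝ≥0∞) = (volume K)⁻¹ * (volume (dyadicCube m q.1.1 q.1.2))⁻¹ *
          (volume K * volume (dyadicCube m q.1.1 q.1.2)) := by
            rw [mul_mul_mul_comm, ENNReal.inv_mul_cancel hK0 hKt,
              ENNReal.inv_mul_cancel (hV0 _) (hVt _), one_mul]
        _ ≤ _ := by gcongr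
    calc ((‖a q.1‖₊ : ℝ≥0∞) * ‖b q.1‖₊) = ((‖a q.1‖₊ : ℝ≥0∞) * ‖b q.1‖₊) * 1 := (mul_one _).symm
      _ ≤ ((‖a q.1‖₊ : ℝ≥0∞) * ‖b q.1‖₊) * ((volume K)⁻¹ *
          (volume (dyadicCube m q.1.1 q.1.2))⁻¹ * (2 * volume ((K ×ˢ E q.1) ∩ F))) := by gcongr
      _ = _ := by ring
  -- pointwise Cauchy-Schwarz
  set S : ((Fin n → ℝ) × (Fin m → ℝ)) → ℝ≥0∞ := fun x =>
    K.indicator (fun _ => (volume K)⁻¹) x.1 *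
      (∑' q : 𝒞, (‖b q.1‖₊ : ℝ≥0∞) ^ 2 *
        (dyadicCube m q.1.1 q.1.2).indicator
          (fun _ => (volume (dyadicCube m q.1.1 q.1.2))⁻¹) x.2) ^ ((1:ℝ)/2) with hS
  have hSm : Measurable S := by
    refine Measurable.mul ((measurable_const.indicator hKm).comp measurable_fst) ?_
    refine Measurable.pow_const ?_ _
    refine Measurable.tsum fun q => ?_
    exact ((measurable_const.indicator (hVm q.1)).comp measurable_snd).const_mul _
  have hsq : ∀ z : ℝ≥0∞, (z ^ ((1:ℝ)/2)) ^ 2 = z := fun z => by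
    rw [← ENNReal.rpow_two, ← ENNReal.rpow_mul]; norm_num
  have h2 : ∀ x, ∑' q : 𝒞, G q x ≤ l ^ ((1:ℝ)/2) * S x := by
    intro x
    by_cases hx : x.1 ∈ K
    swap
    · have : ∀ q, G q x = 0 := fun q => by
        simp [hG, indicator, Set.mem_prod, hx]
      simp [this]
    have e1 : ∀ q : 𝒞, G q x = (volume K)⁻¹ *
        (((‖a q.1‖₊ : ℝ≥0∞) * ((E q.1).indicator
          (fun _ => (volume (dyadicCube m q.1.1 q.1.2))⁻¹) x.2) ^ ((1:ℝ)/2)) *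
        ((‖b q.1‖₊ : ℝ≥0∞) * ((dyadicCube m q.1.1 q.1.2).indicator
          (fun _ => (volume (dyadicCube m q.1.1 q.1.2))⁻¹) x.2) ^ ((1:ℝ)/2))) := by
      intro q
      by_cases hxE : x.2 ∈ E q.1
      · have hxV := hEV _ hxE
        have hm : x ∈ K ×ˢ E q.1 := ⟨hx, hxE⟩
        simp only [hG]
        rw [indicator_of_mem hm, indicator_of_mem hxE, indicator_of_mem hxV]
        have := hsq (volume (dyadicCube m q.1.1 q.1.2))⁻¹
        conv_lhs => rw [← this]
        ring
      · have hm : x ∉ K ×ˢ E q.1 := fun h => hxE h.2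
        simp only [hG]
        rw [indicator_of_notMem hm, indicator_of_notMem hxE]
        simp
    simp_rw [e1]
    rw [ENNReal.tsum_mul_left]
    have hcs := aux_cs (fun q : 𝒞 => (‖a q.1‖₊ : ℝ≥0∞) * ((E q.1).indicator
          (fun _ => (volume (dyadicCube m q.1.1 q.1.2))⁻¹) x.2) ^ ((1:ℝ)/2))
      (fun q : 𝒞 => (‖b q.1‖₊ : ℝ≥0∞) * ((dyadicCube m q.1.1 q.1.2).indicator
          (fun _ => (volume (dyadicCube m q.1.1 q.1.2))⁻¹) x.2) ^ ((1:ℝ)/2))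
    simp only [mul_pow, hsq] at hcs
    have hp := aux_pointwise m 𝒞 a l x.2
    simp only [hS]
    rw [indicator_of_mem hx]
    calc _ ≤ (volume K)⁻¹ * (l ^ ((1:ℝ)/2) * (∑' q : 𝒞, (‖b q.1‖₊ : ℝ≥0∞) ^ 2 *
        (dyadicCube m q.1.1 q.1.2).indicator
          (fun _ => (volume (dyadicCube m q.1.1 q.1.2))⁻¹) x.2) ^ ((1:ℝ)/2)) := by
          refine mul_le_mul_right (hcs.trans ?_) _
          refine mul_le_mul_left ?_ _
          exact ENNReal.rpow_le_rpow hp (by norm_num)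
      _ = _ := by ring
  have hlB : l ^ ((1:ℝ)/2) = (4 * 2 ^ m) ^ ((1:ℝ)/2) * B := by
    rw [hl, ENNReal.mul_rpow_of_nonneg _ _ (by norm_num), ← ENNReal.rpow_two,
      ← ENNReal.rpow_mul]
    norm_num
  calc _ ≤ 2 * ∫⁻ x in F, ∑' q : 𝒞, G q x := h1
    _ ≤ 2 * ∫⁻ x in F, l ^ ((1:ℝ)/2) * S x := by
        gcongr with x
        exact h2 x
    _ = 2 * (l ^ ((1:ℝ)/2) * ∫⁻ x in F, S x) := by rw [lintegral_const_mul _ hSm]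
    _ = _ := by rw [hlB]; ring

end
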